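/- Every sequence of 3091 elements of (ℤ/5ℤ)^6 contains a subsequence of length exactly 5 whose sum is zero; that is, 𝔰((ℤ/5ℤ)^6) ≤ 3091. -/

import Mathlib

open Finset

/-- Every sequence of `N` elements of `(ℤ/5ℤ)^n` has a zero-sum subsequence of length `5`. -/
def HasZeroSumFive (n N : ℕ) : Prop :=
  ∀ v : Fin N → Fin n → ZMod 5, ∃ t : Finset (Fin N), #t = 5 ∧ ∑ i ∈ t, v i = 0

lemma HasZeroSumFive.exists_subset {n N : ℕ} (h : HasZeroSumFive n N) {ι : Type*}
    (v : ι → Fin n → ZMod 5) (s : Finset ι) (hs : N ≤ #s) :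
    ∃ t ⊆ s, #t = 5 ∧ ∑ i ∈ t, v i = 0 := by
  obtain ⟨u, hu, huN⟩ := exists_subset_card_eq hs
  let e : Fin N ↪ ι := (u.equivFinOfCardEq huN).symm.toEmbedding.trans (.subtype _)
  obtain ⟨t, ht, ht0⟩ := h (v ∘ e)
  refine ⟨t.map e, fun i hi ↦ ?_, by simpa using ht, by simpa using ht0⟩
  obtain ⟨j, -, rfl⟩ := mem_map.1 hi
  exact hu ((u.equivFinOfCardEq huN).symm j).2

/-- The subsets of `s` of size divisible by `5` on which `v` sums to zero. -/
def zeroSumSubsets {ι : Type*} {n : ℕ} (v : ι → Fin n → ZMod 5) (s : Finset ι) :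
    Finset (Finset ι) :=
  {t ∈ s.powerset | 5 ∣ #t ∧ ∑ i ∈ t, v i = 0}

open MvPolynomial in
/-- A consequence of the Chevalley–Warning theorem: a signed count of zero-sum subsets. -/
lemma sum_zeroSumSubsets {ι : Type*} [Fintype ι] [DecidableEq ι] {n : ℕ}
    (v : ι → Fin n → ZMod 5) (s : Finset ι) (hs : 4 * (n + 1) < #s) :
    ∑ t ∈ zeroSumSubsets v s, (-1 : ZMod 5) ^ #t = 0 := by
  have hpow : ∀ x : ZMod 5, x ^ 4 = if x ≠ 0 then 1 else 0 := by decide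
  have : Fact (Nat.Prime 5) := ⟨by norm_num⟩
  let f : (Option (Fin n) ⊕ {i // i ∉ s}) → MvPolynomial ι (ZMod 5) :=
    Sum.elim (fun k ↦ ∑ i, k.elim 1 (v i) • X i ^ 4) (fun i ↦ X i.1)
  have hdeg : ∑ k, (f k).totalDegree < Fintype.card ι := by
    have h1 (k : Option (Fin n)) : (f (.inl k)).totalDegree ≤ 4 :=
      totalDegree_finsetSum_le fun i _ ↦
        (totalDegree_smul_le ..).trans (totalDegree_X_pow ..).le
    have h2 (i : {i // i ∉ s}) : (f (.inr i)).totalDegree ≤ 1 := (totalDegree_X _).le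
    have h3 := sum_le_sum fun k (_ : k ∈ univ) ↦ h1 k
    have h4 := sum_le_sum fun k (_ : k ∈ univ) ↦ h2 k
    have h5 : Fintype.card {i // i ∉ s} = Fintype.card ι - #s := by
      rw [Fintype.card_subtype_compl, Fintype.card_coe]
    have h6 := s.card_le_univ
    rw [Fintype.sum_sum_type]
    simp only [sum_const, card_univ, Fintype.card_option, Fintype.card_fin, smul_eq_mul] at h3 h4
    omega
  have hdvd := char_dvd_card_solutions_of_fintype_sum_lt 5 hdeg
  have hiff (x : ι → ZMod 5) : (∀ k, eval x (f k) = 0) ↔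
      ({i | x i ≠ 0} : Finset ι) ∈ zeroSumSubsets v s := by
    have h1 : eval x (f (.inl none)) = (#({i | x i ≠ 0} : Finset ι) : ZMod 5) := by
      simp only [f, Sum.elim_inl, Option.elim_none, one_smul, map_sum, map_pow, eval_X, hpow,
        sum_boole]
    have h2 (k : Fin n) : eval x (f (.inl (some k))) =
        (∑ i ∈ ({i | x i ≠ 0} : Finset ι), v i) k := by
      simp [f, hpow, Finset.sum_apply, Finset.sum_filter]
    have h3 (i : {i // i ∉ s}) : eval x (f (.inr i)) = x i := by simp [f]
    rw [Sum.forall, Option.forall, zeroSumSubsets, mem_filter, mem_powerset, h1,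
      ZMod.natCast_eq_zero_iff, _root_.funext_iff]
    simp only [h2, h3, Subtype.forall, Finset.subset_iff, mem_filter, mem_univ, true_and,
      Pi.zero_apply]
    have : (∀ i, x i ≠ 0 → i ∈ s) ↔ ∀ i, i ∉ s → x i = 0 :=
      forall_congr' fun i ↦ by tauto
    rw [this]; tauto
  have hfib (t : Finset ι) : #{x : ι → ZMod 5 | ({i | x i ≠ 0} : Finset ι) = t} = 4 ^ #t := by
    have : ({x : ι → ZMod 5 | ({i | x i ≠ 0} : Finset ι) = t} : Finset _) =
        Fintype.piFinset fun i ↦ if i ∈ t then {0}ᶜ else {0} := by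
      ext x
      simp only [mem_filter, mem_univ, true_and, Finset.ext_iff, Fintype.mem_piFinset]
      refine forall_congr' fun i ↦ ?_
      split_ifs with h <;> simp [h]
    rw [this, Fintype.card_piFinset, ← prod_const, ← prod_subset (subset_univ t)]
    · exact prod_congr rfl fun i hi ↦ by rw [if_pos hi]; rfl
    · intro i _ hi; simp [hi]
  have hcard : Fintype.card {x : ι → ZMod 5 // ∀ k, eval x (f k) = 0} =
      ∑ t ∈ zeroSumSubsets v s, 4 ^ #t := by
    rw [Fintype.card_subtype,
      card_eq_sum_card_fiberwise (f := fun x : ι → ZMod 5 ↦ ({i | x i ≠ 0} : Finset ι))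
      (t := zeroSumSubsets v s)]
    · refine sum_congr rfl fun t ht ↦ ?_
      rw [← hfib, filter_filter]
      congr 1
      ext x
      simp only [mem_filter, mem_univ, true_and, hiff]
      exact ⟨fun h ↦ h.2, fun h ↦ ⟨h ▸ ht, h⟩⟩
    · intro x hx
      exact (hiff x).1 (by simpa using hx)
  rw [hcard, ← ZMod.natCast_eq_zero_iff] at hdvd
  push_cast at hdvd
  exact hdvd

/-- In the absence of zero-sum subsets of size `5`, the number of zero-sum subsets of size `10`
is determined modulo `5`. -/
lemma card_zeroSum_ten {ι : Type*} [Fintype ι] [DecidableEq ι]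
    (v : ι → Fin 2 → ZMod 5) (h5 : ∀ t : Finset ι, #t = 5 → ∑ i ∈ t, v i ≠ 0)
    (s : Finset ι) (hs : 12 < #s) (hs' : #s < 20) :
    (#{t ∈ s.powersetCard 10 | ∑ i ∈ t, v i = 0} : ZMod 5) = -1 := by
  have key (s : Finset ι) (hs : 12 < #s) (hs' : #s < 20)
      (h15 : ∀ t ⊆ s, #t = 15 → ∑ i ∈ t, v i ≠ 0) :
      (#{t ∈ s.powersetCard 10 | ∑ i ∈ t, v i = 0} : ZMod 5) = -1 := by
    have h := sum_zeroSumSubsets v s (by omega)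
    have hset : zeroSumSubsets v s =
        insert ∅ {t ∈ s.powersetCard 10 | ∑ i ∈ t, v i = 0} := by
      ext t
      simp only [zeroSumSubsets, mem_filter, mem_powerset, mem_insert, mem_powersetCard]
      constructor
      · rintro ⟨hts, ⟨m, hm⟩, h0⟩
        have := card_le_card hts
        have : m < 4 := by omega
        interval_cases m
        · left; simpa using hm
        · exact absurd h0 (h5 t hm)
        · exact .inr ⟨⟨hts, hm⟩, h0⟩
        · exact absurd h0 (h15 t hts hm)
      · rintro (rfl | ⟨⟨hts, hm⟩, h0⟩)
        · simp
        · exact ⟨hts, by omega, h0⟩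
    rw [hset, sum_insert (by simp), sum_congr rfl (g := fun _ ↦ 1)] at h
    · simp at h
      linear_combination h
    · intro t ht
      rw [(mem_powersetCard.1 (mem_filter.1 ht).1).2]
      decide
  refine key s hs hs' fun t _ ht h0 ↦ ?_
  obtain ⟨u, hut, hu⟩ := exists_subset_card_eq (s := t) (n := 14) (by omega)
  have h10 := key u (by omega) (by omega) fun w hw h ↦ by have := card_le_card hw; omega
  obtain ⟨w, hw⟩ : ({t ∈ u.powersetCard 10 | ∑ i ∈ t, v i = 0} : Finset _).Nonempty := by
    rw [nonempty_iff_ne_empty]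
    intro h
    rw [h, card_empty] at h10
    exact absurd h10 (by decide)
  rw [mem_filter, mem_powersetCard] at hw
  have hwt := hw.1.1.trans hut
  refine h5 (t \ w) (by rw [card_sdiff_of_subset hwt]; omega) ?_
  have := sum_sdiff (f := v) hwt
  rwa [hw.2, add_zero, h0] at this

lemma hasZeroSumFive_two : HasZeroSumFive 2 19 := by
  intro v
  by_contra! h5
  have hX := card_zeroSum_ten v h5 univ (by simp) (by simp)
  have hY : ∑ s ∈ powersetCard 13 (univ : Finset (Fin 19)),
      (#{t ∈ s.powersetCard 10 | ∑ i ∈ t, v i = 0} : ZMod 5) = ∑ s ∈ powersetCard 13 univ, -1 :=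
    sum_congr rfl fun s hs ↦ by
      have := (mem_powersetCard.1 hs).2
      exact card_zeroSum_ten v h5 s (by omega) (by omega)
  have hcount : ∑ s ∈ powersetCard 13 (univ : Finset (Fin 19)),
      #{t ∈ s.powersetCard 10 | ∑ i ∈ t, v i = 0} =
      ∑ t ∈ powersetCard 10 (univ : Finset (Fin 19)) with ∑ i ∈ t, v i = 0,
        #{s ∈ powersetCard 13 (univ : Finset (Fin 19)) | t ⊆ s} := by
    simp only [card_eq_sum_ones]
    refine sum_comm' fun s t ↦ ?_
    simp only [mem_filter, mem_powersetCard, subset_univ, true_and]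
    constructor
    · exact fun ⟨hs, ⟨hts, ht⟩, h0⟩ ↦ ⟨⟨hs, hts⟩, ht, h0⟩
    · exact fun ⟨⟨hs, hts⟩, ht, h0⟩ ↦ ⟨hs, ⟨hts, ht⟩, h0⟩
  have h84 : ∀ t ∈ ({t ∈ powersetCard 10 (univ : Finset (Fin 19)) | ∑ i ∈ t, v i = 0} : Finset _),
      #{s ∈ powersetCard 13 (univ : Finset (Fin 19)) | t ⊆ s} = 84 := by
    intro t ht
    have ht' := (mem_powersetCard.1 (mem_filter.1 ht).1).2
    rw [card_filter_powersetCard_subset t univ 13 (subset_univ t) (by omega), ht', card_univ,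
      Fintype.card_fin]
    rfl
  rw [sum_congr rfl h84, sum_const, smul_eq_mul] at hcount
  rw [← Nat.cast_sum, hcount, sum_const, card_powersetCard, card_univ, Fintype.card_fin,
    Nat.cast_mul, hX, show Nat.choose 19 13 = 27132 by norm_num [Nat.choose], nsmul_eq_mul] at hY
  push_cast at hY
  reduce_mod_char at hY
  exact absurd hY (by decide)

section Fourier

open ZMod

variable {ι : Type*} [Fintype ι] {n : ℕ}

/-- The character sum of the sequence `v` at the frequency `a`. -/
noncomputable def charSum (v : ι → Fin n → ZMod 5) (a : Fin n → ZMod 5) : ℂ :=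
  ∑ i, stdAddChar (a ⬝ᵥ v i)

lemma stdAddChar_sum {κ : Type*} (s : Finset κ) (g : κ → ZMod 5) :
    (stdAddChar (∑ k ∈ s, g k) : ℂ) = ∏ k ∈ s, stdAddChar (g k) :=
  map_prod (stdAddChar : AddChar (ZMod 5) ℂ).toMonoidHom (fun k ↦ Multiplicative.ofAdd (g k)) s

lemma sum_stdAddChar_dotProduct (x : Fin n → ZMod 5) :
    ∑ a : Fin n → ZMod 5, (stdAddChar (a ⬝ᵥ x) : ℂ) = if x = 0 then 5 ^ n else 0 := by
  have hprod (a : Fin n → ZMod 5) :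
      (stdAddChar (a ⬝ᵥ x) : ℂ) = ∏ k, stdAddChar (a k * x k) := by
    rw [dotProduct, stdAddChar_sum]
  have hcoord (k : Fin n) :
      ∑ b : ZMod 5, (stdAddChar (b * x k) : ℂ) = if x k = 0 then 5 else 0 := by
    simpa using AddChar.sum_mulShift (x k) (isPrimitive_stdAddChar 5)
  simp_rw [hprod]
  rw [← Fintype.prod_sum fun k b ↦ (stdAddChar (b * x k) : ℂ)]
  simp_rw [hcoord]
  split_ifs with hx
  · simp [hx]
  · obtain ⟨k, hk⟩ := Function.ne_iff.1 hx
    exact prod_eq_zero (mem_univ k) (if_neg hk)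

lemma sum_charSum {κ : Type*} [Fintype κ] (g : κ → Fin n → ZMod 5) :
    ∑ a, charSum g a = 5 ^ n * #{k | g k = 0} := by
  simp_rw [charSum]
  rw [sum_comm]
  simp_rw [sum_stdAddChar_dotProduct, ← sum_filter, sum_const, nsmul_eq_mul]
  ring

lemma charSum_zero (v : ι → Fin n → ZMod 5) : charSum v 0 = Fintype.card ι := by
  simp [charSum]

lemma charSum_pow (v : ι → Fin n → ZMod 5) (m : ℕ) (a : Fin n → ZMod 5) :
    charSum v a ^ m = charSum (fun f : Fin m → ι ↦ ∑ k, v (f k)) a := by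
  simp_rw [charSum, Fintype.sum_pow, dotProduct_sum, stdAddChar_sum]

lemma charSum_mul {κ : Type*} [Fintype κ] (v : ι → Fin n → ZMod 5) (w : κ → Fin n → ZMod 5)
    (a : Fin n → ZMod 5) :
    charSum v a * charSum w a = charSum (fun p : ι × κ ↦ v p.1 + w p.2) a := by
  simp_rw [charSum, sum_mul_sum, Fintype.sum_prod_type, dotProduct_add, AddChar.map_add_eq_mul]

lemma norm_charSum_sq (v : ι → Fin n → ZMod 5) (a : Fin n → ZMod 5) :
    ((‖charSum v a‖ ^ 2 : ℝ) : ℂ) = charSum (fun p : ι × ι ↦ v p.1 + -v p.2) a := by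
  rw [← charSum_mul v (fun i ↦ -v i), Complex.ofReal_pow, ← Complex.mul_conj']
  congr 1
  simp [charSum, map_sum, dotProduct_neg, AddChar.map_neg_eq_conj]

/-- Parseval's identity, for a sequence taking each value at most `4` times. -/
lemma sum_norm_charSum_sq_le (v : ι → Fin n → ZMod 5) (hv : ∀ x, #{i | v i = x} ≤ 4) :
    ∑ a, ‖charSum v a‖ ^ 2 ≤ 5 ^ n * (4 * Fintype.card ι : ℝ) := by
  have h : ((∑ a, ‖charSum v a‖ ^ 2 : ℝ) : ℂ) =
      ((5 ^ n * (#{p : ι × ι | v p.1 + -v p.2 = 0} : ℝ) : ℝ) : ℂ) := by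
    rw [Complex.ofReal_sum]
    simp_rw [norm_charSum_sq]
    rw [sum_charSum]
    push_cast
    rfl
  rw [Complex.ofReal_inj.1 h]
  have hcard : #{p : ι × ι | v p.1 + -v p.2 = 0} ≤ 4 * Fintype.card ι := by
    rw [card_filter, Fintype.sum_prod_type_right]
    simp_rw [← card_filter, ← sub_eq_add_neg, sub_eq_zero]
    refine (sum_le_sum fun j _ ↦ hv (v j)).trans ?_
    simp [mul_comm]
  gcongr
  exact_mod_cast hcard

/-- A nontrivial character sum is small if all hyperplanes contain few terms of the sequence. -/
lemma norm_charSum_le {M : ℕ} (v : ι → Fin n → ZMod 5) (a : Fin n → ZMod 5)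
    (hM : ∀ j, #{i | a ⬝ᵥ v i = j} ≤ M) :
    ‖charSum v a‖ ≤ 5 * M - Fintype.card ι := by
  have hfib : charSum v a = ∑ j : ZMod 5, (#{i | a ⬝ᵥ v i = j} : ℂ) * stdAddChar j := by
    rw [charSum, ← sum_fiberwise univ (fun i ↦ a ⬝ᵥ v i)]
    refine sum_congr rfl fun j _ ↦ ?_
    rw [sum_congr rfl (g := fun _ ↦ (stdAddChar j : ℂ)), sum_const, nsmul_eq_mul]
    intro i hi
    rw [(mem_filter.1 hi).2]
  have hzero : ∑ j : ZMod 5, (stdAddChar j : ℂ) = 0 := by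
    simpa [show (1 : ZMod 5) ≠ 0 by decide] using
      AddChar.sum_mulShift (1 : ZMod 5) (isPrimitive_stdAddChar 5)
  have hcompl : charSum v a =
      -∑ j : ZMod 5, ((M : ℂ) - #{i | a ⬝ᵥ v i = j}) * stdAddChar j := by
    simp_rw [sub_mul, sum_sub_distrib, ← mul_sum, hzero, hfib]
    ring
  have hcard : ∑ j : ZMod 5, (#{i | a ⬝ᵥ v i = j} : ℝ) = Fintype.card ι := by
    exact_mod_cast (card_eq_sum_card_fiberwise (s := (univ : Finset ι))
      (f := fun i ↦ a ⬝ᵥ v i) (t := univ) (by simp)).symm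
  calc ‖charSum v a‖ ≤ ∑ j : ZMod 5, ‖((M : ℂ) - #{i | a ⬝ᵥ v i = j}) * stdAddChar j‖ := by
        rw [hcompl, norm_neg]
        exact norm_sum_le _ _
    _ = ∑ j : ZMod 5, ((M : ℝ) - #{i | a ⬝ᵥ v i = j}) := by
        refine sum_congr rfl fun j _ ↦ ?_
        have : (#{i | a ⬝ᵥ v i = j} : ℝ) ≤ M := by exact_mod_cast hM j
        rw [norm_mul, AddChar.norm_apply, mul_one]
        simpa using Complex.norm_of_nonneg (sub_nonneg.2 this)
    _ = 5 * M - Fintype.card ι := by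
        rw [sum_sub_distrib, hcard]
        simp [ZMod.card]

/-- If no five terms sum to zero, every zero-sum tuple of length five repeats an index. -/
lemma card_zeroSum_tuples_le (v : ι → Fin n → ZMod 5)
    (hv : ∀ t : Finset ι, #t = 5 → ∑ i ∈ t, v i ≠ 0) :
    #{f : Fin 5 → ι | ∑ k, v (f k) = 0} ≤
      10 * #{p : ι × (Fin 3 → ι) | (v p.1 + v p.1) + ∑ k, v (p.2 k) = 0} := by
  classical
  let P : Finset (Fin 5 × Fin 5) := {q | q.1 < q.2}
  have hsub : ({f : Fin 5 → ι | ∑ k, v (f k) = 0} : Finset _) ⊆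
      P.biUnion fun q ↦ {f : Fin 5 → ι | ∑ k, v (f k) = 0 ∧ f q.1 = f q.2} := by
    intro f hf
    have hf0 := (mem_filter.1 hf).2
    have hinj : ¬ Function.Injective f := fun hinj ↦
      hv (univ.map ⟨f, hinj⟩) (by simp) (by simpa using hf0)
    obtain ⟨i, j, hij, hne⟩ : ∃ i j, f i = f j ∧ i ≠ j := by
      simpa [Function.Injective] using hinj
    rw [mem_biUnion]
    rcases lt_or_gt_of_ne hne with h | h
    · exact ⟨(i, j), by simp [P, h], by simp [hf0, hij]⟩
    · exact ⟨(j, i), by simp [P, h], by simp [hf0, hij]⟩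
  have hpair : ∀ q ∈ P, #{f : Fin 5 → ι | ∑ k, v (f k) = 0 ∧ f q.1 = f q.2} ≤
      #{p : ι × (Fin 3 → ι) | (v p.1 + v p.1) + ∑ k, v (p.2 k) = 0} := by
    rintro ⟨i, j⟩ hq
    have hij : i < j := (mem_filter.1 hq).2
    obtain ⟨σ, h0, h1⟩ : ∃ σ : Equiv.Perm (Fin 5), σ 0 = i ∧ σ 1 = j :=
      ⟨(Equiv.swap 1 (Equiv.swap 0 i j)).trans (Equiv.swap 0 i), by
        clear * - hij; revert i j; decide, by clear * - hij; revert i j; decide⟩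
    refine card_le_card_of_injOn (fun f ↦ (f (σ 0), fun k : Fin 3 ↦ f (σ k.succ.succ))) ?_ ?_
    · intro f hf
      obtain ⟨hf0, hfij⟩ : ∑ k, v (f k) = 0 ∧ f i = f j := by simpa using hf
      have : v (f (σ 0)) + v (f (σ 0)) + ∑ k : Fin 3, v (f (σ k.succ.succ)) = 0 := by
        rw [← hf0, ← Equiv.sum_comp σ fun k ↦ v (f k), Fin.sum_univ_succ (n := 4),
          Fin.sum_univ_succ (n := 3), add_assoc, Fin.succ_zero_eq_one, h1, ← hfij, h0]
      simpa using this
    · intro f hf g hg hfg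
      obtain ⟨-, hfij⟩ : ∑ k, v (f k) = 0 ∧ f i = f j := by simpa using hf
      obtain ⟨-, hgij⟩ : ∑ k, v (g k) = 0 ∧ g i = g j := by simpa using hg
      rw [Prod.mk.injEq] at hfg
      funext k
      obtain ⟨k, rfl⟩ := σ.surjective k
      refine Fin.cases hfg.1 (fun k ↦ Fin.cases ?_ (fun k ↦ congr_fun hfg.2 k) k) k
      rw [Fin.succ_zero_eq_one, h1, ← hfij, ← hgij, ← h0]
      exact hfg.1
  calc _ ≤ _ := card_le_card hsub
    _ ≤ _ := card_biUnion_le_card_mul _ _ _ hpair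
    _ = _ := by rw [show #P = 10 by decide]

end Fourier

/-- A sequence without five terms summing to zero has few terms in each hyperplane. -/
lemma HasZeroSumFive.card_hyperplane_le {n M : ℕ} (h : HasZeroSumFive n (M + 1)) {ι : Type*}
    [Fintype ι] (v : ι → Fin (n + 1) → ZMod 5)
    (hv : ∀ t : Finset ι, #t = 5 → ∑ i ∈ t, v i ≠ 0) {a : Fin (n + 1) → ZMod 5} (ha : a ≠ 0)
    (j : ZMod 5) : #{i | a ⬝ᵥ v i = j} ≤ M := by
  have : Fact (Nat.Prime 5) := ⟨by norm_num⟩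
  by_contra! hlt
  obtain ⟨l, hl⟩ := Function.ne_iff.1 ha
  obtain ⟨t, hts, ht, ht0⟩ := h.exists_subset (fun i k ↦ v i (l.succAbove k)) _ hlt
  have hcoord (k : Fin n) : (∑ i ∈ t, v i) (l.succAbove k) = 0 := by
    simpa [Finset.sum_apply] using congr_fun ht0 k
  have hdot : a ⬝ᵥ ∑ i ∈ t, v i = 0 := by
    rw [dotProduct_sum, sum_congr rfl fun i hi ↦ (mem_filter.1 (hts hi)).2, sum_const, ht,
      nsmul_eq_mul]
    exact mul_eq_zero_of_left (CharP.cast_eq_zero (ZMod 5) 5) j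
  rw [dotProduct, Fin.sum_univ_succAbove _ l] at hdot
  simp only [hcoord, mul_zero, sum_const_zero, add_zero] at hdot
  have hl0 := (mul_eq_zero.1 hdot).resolve_left hl
  refine hv t ht (funext fun k ↦ ?_)
  rcases Fin.eq_self_or_eq_succAbove l k with rfl | ⟨k, rfl⟩
  · exact hl0
  · exact hcoord k

/-- The inductive step on the rank: the character sums at nonzero frequencies are too small to
allow every zero-sum tuple of length five to repeat an index. -/
lemma HasZeroSumFive.succ {n M N : ℕ} (h : HasZeroSumFive n (M + 1))
    (hN : 10 * (N : ℝ) ^ 4 + ((5 * M - N : ℝ) ^ 3 + 10 * (5 * M - N) ^ 2) *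
      (4 * 5 ^ (n + 1) * N - N ^ 2) < N ^ 5) : HasZeroSumFive (n + 1) N := by
  intro v
  by_contra! hv
  set L : ℝ := 5 * M - N
  have hL (a : Fin (n + 1) → ZMod 5) (ha : a ≠ 0) : ‖charSum v a‖ ≤ L := by
    simpa using norm_charSum_le v a (h.card_hyperplane_le v hv ha)
  have hmult (x : Fin (n + 1) → ZMod 5) : #{i | v i = x} ≤ 4 := by
    by_contra! hlt
    obtain ⟨t, hts, ht⟩ := exists_subset_card_eq (Nat.succ_le_of_lt hlt)
    refine hv t ht ?_
    rw [sum_congr rfl fun i hi ↦ (mem_filter.1 (hts hi)).2, sum_const, ht]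
    funext k
    rw [Pi.smul_apply, nsmul_eq_mul]
    exact mul_eq_zero_of_left (CharP.cast_eq_zero (ZMod 5) 5) _
  have hsplit {E : Type} [AddCommMonoid E] (F : (Fin (n + 1) → ZMod 5) → E) :
      ∑ a, F a = F 0 + ∑ a ∈ univ.erase 0, F a := (add_sum_erase _ _ (mem_univ 0)).symm
  have hQ : ∑ a ∈ univ.erase 0, ‖charSum v a‖ ^ 2 ≤ 4 * 5 ^ (n + 1) * N - N ^ 2 := by
    have := sum_norm_charSum_sq_le v hmult
    rw [hsplit, charSum_zero, Complex.norm_natCast, Fintype.card_fin] at this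
    linarith
  set Q := ∑ a ∈ univ.erase 0, ‖charSum v a‖ ^ 2
  let D : ℕ := #{f : Fin 5 → Fin N | ∑ k, v (f k) = 0}
  let E : ℕ := #{p : Fin N × (Fin 3 → Fin N) | (v p.1 + v p.1) + ∑ k, v (p.2 k) = 0}
  have hDE : (D : ℝ) ≤ 10 * E := by exact_mod_cast card_zeroSum_tuples_le v hv
  have hD : (N : ℝ) ^ 5 - L ^ 3 * Q ≤ 5 ^ (n + 1) * D := by
    have hsum : ∑ a, charSum v a ^ 5 = 5 ^ (n + 1) * (D : ℂ) := by
      simp_rw [charSum_pow]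
      exact sum_charSum _
    rw [hsplit, charSum_zero, Fintype.card_fin] at hsum
    have hR : ‖∑ a ∈ univ.erase 0, charSum v a ^ 5‖ ≤ L ^ 3 * Q := by
      refine (norm_sum_le _ _).trans ?_
      rw [mul_sum]
      refine sum_le_sum fun a ha ↦ ?_
      rw [norm_pow, show 5 = 3 + 2 from rfl, pow_add]
      gcongr
      exact hL a (ne_of_mem_erase ha)
    have hnorm : ‖(N : ℂ) ^ 5‖ ≤ ‖5 ^ (n + 1) * (D : ℂ)‖ + L ^ 3 * Q := by
      rw [eq_sub_of_add_eq hsum]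
      exact (norm_sub_le _ _).trans (by gcongr)
    simp only [norm_pow, norm_mul, Complex.norm_natCast, Complex.norm_ofNat] at hnorm
    linarith
  have hE : 5 ^ (n + 1) * (E : ℝ) ≤ N ^ 4 + L ^ 2 * Q := by
    have hdouble (a : Fin (n + 1) → ZMod 5) :
        charSum (fun i ↦ v i + v i) a = charSum v (a + a) := by
      simp [charSum, dotProduct_add, add_dotProduct]
    have hsum : ∑ a, charSum v (a + a) * charSum v a ^ 3 = 5 ^ (n + 1) * (E : ℂ) := by
      simp_rw [charSum_pow, ← hdouble, charSum_mul]
      exact sum_charSum _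
    rw [hsplit, add_zero, charSum_zero, Fintype.card_fin] at hsum
    have hR : ‖∑ a ∈ univ.erase 0, charSum v (a + a) * charSum v a ^ 3‖ ≤ L ^ 2 * Q := by
      refine (norm_sum_le _ _).trans ?_
      rw [mul_sum]
      refine sum_le_sum fun a ha ↦ ?_
      have ha0 := ne_of_mem_erase ha
      have haa : a + a ≠ 0 := fun h0 ↦ ha0 <| funext fun k ↦ by
        have hz : ∀ z : ZMod 5, z + z = 0 → z = 0 := by decide
        exact hz _ (congr_fun h0 k)
      have hL0 : 0 ≤ L := (norm_nonneg _).trans (hL a ha0)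
      calc _ = ‖charSum v (a + a)‖ * ‖charSum v a‖ * ‖charSum v a‖ ^ 2 := by
            rw [norm_mul, norm_pow]; ring
        _ ≤ L * L * ‖charSum v a‖ ^ 2 := by
            gcongr
            exacts [hL _ haa, hL a ha0]
        _ = _ := by ring
    have hnorm : ‖5 ^ (n + 1) * (E : ℂ)‖ ≤ ‖(N : ℂ) * N ^ 3‖ + L ^ 2 * Q := by
      rw [← hsum]
      exact (norm_add_le _ _).trans (by gcongr)
    simp only [norm_pow, norm_mul, Complex.norm_natCast, Complex.norm_ofNat] at hnorm
    linarith
  have hL23 : 0 ≤ L ^ 3 + 10 * L ^ 2 := by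
    have hL0 : 0 ≤ L := (norm_nonneg _).trans
      (hL 1 fun h1 ↦ absurd (congr_fun h1 0) (by decide : (1 : ZMod 5) ≠ 0))
    positivity
  have h5 : (0 : ℝ) ≤ 5 ^ (n + 1) := by positivity
  linarith [mul_le_mul_of_nonneg_left hDE h5, mul_le_mul_of_nonneg_left hQ hL23]

lemma hasZeroSumFive_six : HasZeroSumFive 6 3091 := by
  have h3 : HasZeroSumFive 3 63 := hasZeroSumFive_two.succ (by norm_num)
  have h4 : HasZeroSumFive 4 220 := h3.succ (by norm_num)
  have h5 : HasZeroSumFive 5 800 := h4.succ (by norm_num)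
  exact h5.succ (by norm_num)

theorem s_const_zmod5_pow6_le :
    ∀ S : Multiset (Fin 6 → ZMod 5), S.card = 3091 →
      ∃ T : Multiset (Fin 6 → ZMod 5), T ≤ S ∧ T.card = 5 ∧ T.sum = 0 := by
  intro S hS
  obtain ⟨l, rfl⟩ : ∃ l : List (Fin 6 → ZMod 5), (l : Multiset _) = S := ⟨_, S.coe_toList⟩
  have h6 := hasZeroSumFive_six
  rw [← hS, Multiset.coe_card] at h6
  obtain ⟨t, ht, ht0⟩ := h6 l.get
  refine ⟨t.val.map l.get, ?_, by rw [Multiset.card_map]; exact ht, ht0⟩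
  calc t.val.map l.get ≤ (univ : Finset (Fin l.length)).val.map l.get :=
        Multiset.map_le_map (val_le_iff.2 (subset_univ t))
    _ = (l : Multiset _) := by
      rw [Fin.univ_def]
      simp
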